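/- arXiv:1607.00956 — 2 statements merged into one kernel-verified Lean document; each statement's English description precedes it below -/
import Mathlib

section
/- Let q0 be a probability distribution on X with full support and let r0 be any probability distribution on X. Then the dot product of r0 with the gradient of W_d evaluated at q0 satisfies Σ_{x0} r0(x0) · [ −Σ_{x1} P(x1|x0) ln((q0P)(x1)) + ln q0(x0) − Q(x0) ] = W_d(r0) − D(r0‖q0) + D(r0P‖q0P), where terms with P(x1|x0) = 0 are taken to be 0. -/
open Finset

/-- `p` is a probability distribution on the finite set `X`. -/
def IsProb {X : Type*} [Fintype X] (p : X → ℝ) : Prop :=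
  (∀ x, 0 ≤ p x) ∧ ∑ x, p x = 1

/-- `P` is a row-stochastic kernel on `X`; `P x0 x1` denotes `P(x1|x0)`. -/
def IsKernel {X : Type*} [Fintype X] (P : X → X → ℝ) : Prop :=
  (∀ x0 x1, 0 ≤ P x0 x1) ∧ ∀ x0, ∑ x1, P x0 x1 = 1

/-- Push-forward of `p` under the kernel `P`: `(pP)(x1) = Σ_{x0} p(x0) P(x1|x0)`. -/
def push {X : Type*} [Fintype X] (P : X → X → ℝ) (p : X → ℝ) : X → ℝ :=
  fun x1 => ∑ x0, p x0 * P x0 x1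

/-- Shannon entropy with natural logarithm (`Real.log 0 = 0` gives the `0 ln 0 = 0` convention). -/
noncomputable def shannon {X : Type*} [Fintype X] (p : X → ℝ) : ℝ :=
  -∑ x, p x * Real.log (p x)

/-- Dissipation functional `W_d(p) = S(pP) − S(p) − Σ_x p(x) Q(x)`. -/
noncomputable def Wd {X : Type*} [Fintype X] (P : X → X → ℝ) (Q : X → ℝ) (p : X → ℝ) : ℝ :=
  shannon (push P p) - shannon p - ∑ x, p x * Q x

/-- Kullback–Leibler divergence `D(r‖q) = Σ_x r(x) ln(r(x)/q(x))`
(terms with `r x = 0` vanish since `0 * log _ = 0`). -/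
noncomputable def KL {X : Type*} [Fintype X] (r q : X → ℝ) : ℝ :=
  ∑ x, r x * Real.log (r x / q x)

/-- If `r` vanishes wherever `q` does, `D(r‖q)` is cross entropy minus entropy. -/
theorem KL_eq_neg_shannon_sub {X : Type*} [Fintype X] {r q : X → ℝ}
    (h : ∀ x, q x = 0 → r x = 0) :
    KL r q = -shannon r - ∑ x, r x * Real.log (q x) := by
  rw [KL, shannon, neg_neg, ← sum_sub_distrib]
  refine sum_congr rfl fun x _ => ?_
  by_cases hr : r x = 0
  · simp [hr]
  · rw [Real.log_div hr (mt (h x) hr), mul_sub]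

/-- The push-forward of `r` vanishes wherever that of a full-support `q` does. -/
theorem push_eq_zero_of_push_eq_zero {X : Type*} [Fintype X] {P : X → X → ℝ}
    (hP : ∀ x y, 0 ≤ P x y) {q : X → ℝ} (hq : ∀ x, 0 < q x) (r : X → ℝ) {y : X}
    (h : push P q y = 0) : push P r y = 0 := by
  have h0 := (sum_eq_zero_iff_of_nonneg fun x _ => mul_nonneg (hq x).le (hP x y)).1 h
  refine sum_eq_zero fun x hx => ?_
  rw [(mul_eq_zero.1 (h0 x hx)).resolve_left (hq x).ne', mul_zero]

/-- Averaging `f` over the kernel and then over `r` is averaging over the push-forward. -/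
theorem sum_push_mul {X : Type*} [Fintype X] (P : X → X → ℝ) (r f : X → ℝ) :
    ∑ y, push P r y * f y = ∑ x, r x * ∑ y, P x y * f y := by
  simp only [push, sum_mul, mul_sum, mul_assoc]
  exact sum_comm

/-- The dot product of `r0` with the gradient of `W_d` evaluated at a
full-support distribution `q0` equals `W_d(r0) − D(r0‖q0) + D(r0P‖q0P)`.
(Terms with `P(x1|x0) = 0` vanish automatically since `0 * log _ = 0`.) -/
theorem dot_product_gradient_at_prior {X : Type*} [Fintype X] [Nonempty X]
    (P : X → X → ℝ) (Q : X → ℝ) (hP : IsKernel P)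
    (q0 : X → ℝ) (hq : IsProb q0) (hqfull : ∀ x, 0 < q0 x)
    (r0 : X → ℝ) (hr : IsProb r0) :
    ∑ x0, r0 x0 *
        (-(∑ x1, P x0 x1 * Real.log (push P q0 x1)) + Real.log (q0 x0) - Q x0)
      = Wd P Q r0 - KL r0 q0 + KL (push P r0) (push P q0) := by
  rw [KL_eq_neg_shannon_sub fun x hx => absurd hx (hqfull x).ne',
    KL_eq_neg_shannon_sub fun y => push_eq_zero_of_push_eq_zero hP.1 hqfull r0,
    sum_push_mul, Wd]
  simp only [mul_sub, mul_add, mul_neg, sum_sub_distrib, sum_add_distrib, sum_neg_distrib]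
  ring
end

section
/- The dissipation functional W_d is convex on the simplex of probability distributions on X: for all probability distributions p and p' on X and all λ ∈ [0,1], W_d(λp + (1−λ)p') ≤ λ W_d(p) + (1−λ) W_d(p'). -/
open Finset

/-- Tangent-line bound for the relative-entropy integrand `a log (a / m)` at `(A, M)`. -/
lemma tangent_le_mul_log_sub {a m A M : ℝ} (ha : 0 ≤ a) (ham : a ≤ m)
    (hA : 0 ≤ A) (hAM : A ≤ M) (h : 0 < a → 0 < A) :
    a * (Real.log A - Real.log M) + (a - m * (A / M)) ≤ a * (Real.log a - Real.log m) := by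
  rcases ha.eq_or_lt with rfl | ha'
  · have : 0 ≤ m * (A / M) := mul_nonneg ham (div_nonneg hA (hA.trans hAM))
    simpa using this
  · have hA' := h ha'
    have hM : 0 < M := hA'.trans_le hAM
    have hm : 0 < m := ha'.trans_le ham
    have hlog := Real.log_le_sub_one_of_pos (show 0 < (m * A) / (a * M) by positivity)
    rw [Real.log_div (by positivity) (by positivity), Real.log_mul hm.ne' hA'.ne',
      Real.log_mul ha'.ne' hM.ne'] at hlog
    have hmul := mul_le_mul_of_nonneg_left hlog ha
    have hcancel : a * ((m * A) / (a * M) - 1) = m * (A / M) - a := by field_simp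
    rw [hcancel] at hmul
    linarith

/-- Data processing inequality for the unnormalised relative entropy of `a` with respect to a
dominating `m`. -/
lemma sum_push_mul_log_sub_le {X : Type*} [Fintype X] {P : X → X → ℝ} (hP : IsKernel P)
    {a m : X → ℝ} (ha : ∀ x, 0 ≤ a x) (ham : ∀ x, a x ≤ m x) :
    ∑ y, push P a y * (Real.log (push P a y) - Real.log (push P m y))
      ≤ ∑ x, a x * (Real.log (a x) - Real.log (m x)) := by
  have hterm (x y : X) : 0 ≤ a x * P x y := mul_nonneg (ha x) (hP.1 x y)
  have hA (y : X) : 0 ≤ push P a y := Finset.sum_nonneg fun x _ => hterm x y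
  have hAM (y : X) : push P a y ≤ push P m y :=
    Finset.sum_le_sum fun x _ => mul_le_mul_of_nonneg_right (ham x) (hP.1 x y)
  have key (y : X) : push P a y * (Real.log (push P a y) - Real.log (push P m y))
      ≤ ∑ x, P x y * (a x * (Real.log (a x) - Real.log (m x))) := by
    have hcancel : push P m y * (push P a y / push P m y) = push P a y :=
      mul_div_cancel_of_imp' fun h => le_antisymm (h ▸ hAM y) (hA y)
    calc push P a y * (Real.log (push P a y) - Real.log (push P m y))
        = push P a y * (Real.log (push P a y) - Real.log (push P m y))
          + (push P a y - push P m y * (push P a y / push P m y)) := by rw [hcancel]; ring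
      _ = ∑ x, P x y * (a x * (Real.log (push P a y) - Real.log (push P m y))
          + (a x - m x * (push P a y / push P m y))) := by
        generalize Real.log (push P a y) - Real.log (push P m y) = c
        generalize push P a y / push P m y = d
        simp only [push, Finset.sum_mul, ← Finset.sum_sub_distrib, ← Finset.sum_add_distrib]
        exact Finset.sum_congr rfl fun x _ => by ring
      _ ≤ _ := by
        refine Finset.sum_le_sum fun x _ => ?_
        rcases (hP.1 x y).eq_or_lt with h | h
        · simp [← h]
        · refine mul_le_mul_of_nonneg_left ?_ h.le
          refine tangent_le_mul_log_sub (ha x) (ham x) (hA y) (hAM y) fun hax => ?_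
          exact (mul_pos hax h).trans_le
            (Finset.single_le_sum (fun z _ => hterm z y) (Finset.mem_univ x))
  calc _ ≤ ∑ y, ∑ x, P x y * (a x * (Real.log (a x) - Real.log (m x))) :=
        Finset.sum_le_sum fun y _ => key y
    _ = _ := by
        rw [Finset.sum_comm]
        simp only [← Finset.sum_mul, hP.2, one_mul]

lemma sum_push {X : Type*} [Fintype X] {P : X → X → ℝ} (hP : IsKernel P) (p : X → ℝ) :
    ∑ y, push P p y = ∑ x, p x := by
  simp only [push]
  rw [Finset.sum_comm]
  simp only [← Finset.mul_sum, hP.2, mul_one]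

lemma shannon_const_mul {X : Type*} [Fintype X] (c : ℝ) (p : X → ℝ) :
    shannon (fun x => c * p x) = c * shannon p - c * Real.log c * ∑ x, p x := by
  have h (x : X) : c * p x * Real.log (c * p x)
      = c * (p x * Real.log (p x)) + c * Real.log c * p x := by
    have := Real.negMulLog_mul c (p x)
    simp only [Real.negMulLog] at this
    linarith
  simp only [shannon, h, Finset.sum_add_distrib, ← Finset.mul_sum]
  ring

lemma push_const_mul {X : Type*} [Fintype X] (P : X → X → ℝ) (c : ℝ) (p : X → ℝ) :
    push P (fun x => c * p x) = fun y => c * push P p y := by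
  funext y
  simp only [push, Finset.mul_sum, mul_assoc]

/-- The dissipation functional is positively homogeneous. -/
lemma Wd_const_mul {X : Type*} [Fintype X] {P : X → X → ℝ} (hP : IsKernel P) (Q : X → ℝ)
    (c : ℝ) (p : X → ℝ) : Wd P Q (fun x => c * p x) = c * Wd P Q p := by
  simp only [Wd, push_const_mul, shannon_const_mul, sum_push hP, mul_assoc, ← Finset.mul_sum]
  ring

/-- The dissipation functional is subadditive on nonnegative functions. -/
lemma Wd_add_le {X : Type*} [Fintype X] {P : X → X → ℝ} (hP : IsKernel P) (Q : X → ℝ)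
    {a b : X → ℝ} (ha : ∀ x, 0 ≤ a x) (hb : ∀ x, 0 ≤ b x) :
    Wd P Q (fun x => a x + b x) ≤ Wd P Q a + Wd P Q b := by
  have h₁ := sum_push_mul_log_sub_le hP (m := fun x => a x + b x) ha
    fun x => le_add_of_nonneg_right (hb x)
  have h₂ := sum_push_mul_log_sub_le hP (m := fun x => a x + b x) hb
    fun x => le_add_of_nonneg_left (ha x)
  have hpush (y : X) : push P (fun x => a x + b x) y = push P a y + push P b y := by
    simp only [push, add_mul, Finset.sum_add_distrib]
  simp only [Wd, shannon, hpush, mul_sub, add_mul, Finset.sum_sub_distrib,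
    Finset.sum_add_distrib] at h₁ h₂ ⊢
  linarith

/-- The dissipation functional is convex on the simplex of probability
distributions. -/
theorem dissipation_convex {X : Type*} [Fintype X] [Nonempty X]
    (P : X → X → ℝ) (Q : X → ℝ) (hP : IsKernel P)
    (p p' : X → ℝ) (hp : IsProb p) (hp' : IsProb p')
    (l : ℝ) (hl0 : 0 ≤ l) (hl1 : l ≤ 1) :
    Wd P Q (fun x => l * p x + (1 - l) * p' x)
      ≤ l * Wd P Q p + (1 - l) * Wd P Q p' := by
  have h := Wd_add_le hP Q (fun x => mul_nonneg hl0 (hp.1 x))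
    (fun x => mul_nonneg (sub_nonneg.2 hl1) (hp'.1 x))
  rwa [Wd_const_mul hP, Wd_const_mul hP] at h
end
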